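/- arXiv:2605.16955 — 4 statements merged into one kernel-verified Lean document; each statement's English description precedes it below -/
import Mathlib

section
/- (Theorem 1, gadget theorem) Let f be the objective function of a Set-Max-LINSAT instance over a finite field F_q with matrix B ∈ F_q^{m×n} and sets F_1, …, F_m ⊆ F_q. Fix an index i ∈ {1, …, m} and a positive integer k. Construct a new Set-Max-LINSAT instance over F_q in the variables (x, y) ∈ F_q^n × F_q^k whose constraints are: for every j ≠ i the constraint b_j · x ∈ F_j; the constraint b_i · x + Σ_{t=1}^k y_t ∈ F_i; and the k constraints y_t ∈ {0} for t = 1, …, k. Let f̂(x, y) denote the objective function of this new instance. Then for every x ∈ F_q^n one has k + f(x) = max over y ∈ F_q^k of f̂(x, y). -/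
open Matrix Finset

/-- **Gadget theorem** (Theorem 1). Given a Set-Max-LINSAT instance over a finite field `F`
with matrix `B` and sets `Fs i`, fixing an index `i` and a positive integer `k`, the new
instance in variables `(x, y)` whose constraints are `B j ⬝ᵥ x ∈ Fs j` for `j ≠ i`,
`B i ⬝ᵥ x + ∑ t, y t ∈ Fs i`, and `y t ∈ {0}` for each `t`, satisfies
`k + f x = max_y f̂ (x, y)`. -/
theorem gadget_theorem {F : Type*} [Field F] [Fintype F] [DecidableEq F]
    {m n k : ℕ} (hk : 0 < k)
    (B : Matrix (Fin m) (Fin n) F) (Fs : Fin m → Finset F) (i : Fin m)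
    (x : Fin n → F) :
    k + (∑ j, if B j ⬝ᵥ x ∈ Fs j then 1 else 0) =
      Finset.univ.sup (fun y : Fin k → F =>
        (∑ j, if (if j = i then B i ⬝ᵥ x + ∑ t, y t else B j ⬝ᵥ x) ∈ Fs j then 1 else 0)
          + ∑ t : Fin k, if y t = 0 then 1 else 0) := by
  apply le_antisymm
  · refine le_trans (le_of_eq ?_) (Finset.le_sup (Finset.mem_univ (0 : Fin k → F)))
    have h : ∀ j, (if j = i then B i ⬝ᵥ x + ∑ t, (0 : Fin k → F) t else B j ⬝ᵥ x)
        = B j ⬝ᵥ x := by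
      intro j
      by_cases hj : j = i
      · subst hj; simp
      · simp [hj]
    simp only [h]
    simp [add_comm]
  · refine Finset.sup_le fun y _ => ?_
    by_cases hy : y = 0
    · subst hy
      have h : ∀ j, (if j = i then B i ⬝ᵥ x + ∑ t, (0 : Fin k → F) t else B j ⬝ᵥ x)
          = B j ⬝ᵥ x := by
        intro j
        by_cases hj : j = i
        · subst hj; simp
        · simp [hj]
      simp only [h]
      simp [add_comm]
    · obtain ⟨t0, ht0⟩ : ∃ t, y t ≠ 0 := by
        by_contra hc
        push Not at hc
        exact hy (funext hc)
      have h1 : (∑ j, if (if j = i then B i ⬝ᵥ x + ∑ t, y t else B j ⬝ᵥ x) ∈ Fs j then 1 else 0)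
          ≤ (∑ j, if B j ⬝ᵥ x ∈ Fs j then 1 else 0) + 1 := by
        calc _ ≤ ∑ j, ((if B j ⬝ᵥ x ∈ Fs j then 1 else 0) + (if j = i then 1 else 0)) := by
              refine Finset.sum_le_sum fun j _ => ?_
              by_cases hj : j = i
              · simp only [hj, if_true]
                split_ifs <;> omega
              · simp [hj]
          _ = _ := by simp [Finset.sum_add_distrib]
      have h2 : (∑ t : Fin k, if y t = 0 then 1 else 0) + 1 ≤ k := by
        calc _ = ∑ t : Fin k, ((if y t = 0 then 1 else 0) + (if t = t0 then 1 else 0)) := by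
              simp [Finset.sum_add_distrib]
          _ ≤ ∑ t : Fin k, 1 := by
              refine Finset.sum_le_sum fun t _ => ?_
              by_cases ht : t = t0
              · simp [ht, ht0]
              · simp only [ht, if_false]
                split_ifs <;> omega
          _ = k := by simp
      omega
end

section
/- (n-variable AND encoding) For n ≥ 1 and x ∈ F_2^n, consider the family of 2^n − 1 Max-XORSAT constraints { b · x = |b| (mod 2) : b ∈ {0,1}^n, |b| > 0 }, where |b| denotes the number of ones in b and b · x is computed in F_2. If x is the all-ones vector, then all 2^n − 1 constraints are satisfied; otherwise exactly 2^{n−1} − 1 of them are satisfied. -/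
open Matrix Finset

lemma hamming_cast {n : ℕ} (b : Fin n → ZMod 2) :
    (hammingNorm b : ZMod 2) = b ⬝ᵥ (fun _ => 1) := by
  have h2 : ∀ a : ZMod 2, (if a ≠ 0 then (1 : ZMod 2) else 0) = a := by decide
  simp only [hammingNorm, dotProduct, mul_one, Finset.card_filter, Nat.cast_sum,
    Nat.cast_ite, Nat.cast_one, Nat.cast_zero, h2]

lemma card_erase_form {n : ℕ} (x : Fin n → ZMod 2) :
    (Finset.univ.filter (fun b : Fin n → ZMod 2 =>
        b ≠ 0 ∧ b ⬝ᵥ x = (hammingNorm b : ZMod 2))).card =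
    (Finset.univ.filter (fun b : Fin n → ZMod 2 => b ⬝ᵥ (x - fun _ => 1) = 0)).card - 1 := by
  rw [← Finset.card_erase_of_mem (a := (0 : Fin n → ZMod 2)) (by simp)]
  congr 1
  ext b
  simp only [Finset.mem_filter, Finset.mem_univ, true_and, Finset.mem_erase, hamming_cast,
    dotProduct_sub, sub_eq_zero]

lemma card_half {n : ℕ} (hn : 1 ≤ n) (y : Fin n → ZMod 2) (hy : y ≠ 0) :
    (Finset.univ.filter (fun b : Fin n → ZMod 2 => b ⬝ᵥ y = 0)).card = 2 ^ (n - 1) := by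
  obtain ⟨i, hi⟩ := Function.ne_iff.mp hy
  have h01 : ∀ a : ZMod 2, a ≠ 0 → a = 1 := by decide
  have hi1 : y i = 1 := h01 _ hi
  have hflip : ∀ a : ZMod 2, a + 1 = 0 ↔ ¬ a = 0 := by decide
  have hflip2 : ∀ a : ZMod 2, ¬ (a + 1 = 0) ↔ a = 0 := by decide
  have heq : (Finset.univ.filter (fun b : Fin n → ZMod 2 => b ⬝ᵥ y = 0)).card =
      (Finset.univ.filter (fun b : Fin n → ZMod 2 => ¬ b ⬝ᵥ y = 0)).card := by
    apply Finset.card_equiv (Equiv.addRight (Pi.single i (1 : ZMod 2)))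
    intro b
    simp only [Finset.mem_filter, Finset.mem_univ, true_and, Equiv.coe_addRight,
      add_dotProduct, single_dotProduct, hi1, mul_one, hflip2]
  have hsum := Finset.card_filter_add_card_filter_not (s := Finset.univ)
    (fun b : Fin n → ZMod 2 => b ⬝ᵥ y = 0)
  have hc : (Finset.univ : Finset (Fin n → ZMod 2)).card = 2 ^ n := by
    simp [ZMod.card]
  obtain ⟨m, rfl⟩ : ∃ m, n = m + 1 := ⟨n - 1, by omega⟩
  rw [hc, pow_succ] at hsum
  simp only [Nat.add_sub_cancel]
  omega

/-- **n-variable AND encoding.** For `n ≥ 1` and `x : Fin n → ZMod 2`, among the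
`2^n - 1` Max-XORSAT constraints `b ⬝ᵥ x = |b| (mod 2)` for nonzero `b : Fin n → ZMod 2`
(where `|b|` is the Hamming weight of `b`): if `x` is the all-ones vector then all
`2^n - 1` constraints are satisfied; otherwise exactly `2^(n-1) - 1` are satisfied. -/
theorem and_encoding {n : ℕ} (hn : 1 ≤ n) (x : Fin n → ZMod 2) :
    (x = (fun _ => 1) →
      (Finset.univ.filter (fun b : Fin n → ZMod 2 =>
        b ≠ 0 ∧ b ⬝ᵥ x = (hammingNorm b : ZMod 2))).card = 2 ^ n - 1) ∧
    (x ≠ (fun _ => 1) →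
      (Finset.univ.filter (fun b : Fin n → ZMod 2 =>
        b ≠ 0 ∧ b ⬝ᵥ x = (hammingNorm b : ZMod 2))).card = 2 ^ (n - 1) - 1) := by
  constructor
  · rintro rfl
    rw [card_erase_form]
    simp [ZMod.card]
  · intro hx
    rw [card_erase_form, card_half hn _ (sub_ne_zero.mpr hx)]
end

section
/- (Correctness of the modular encoding of integer ordering constraints) Let n ≥ 1, let l, u ∈ ℤ^n with l_j ≤ u_j for all j, and let X = {x ∈ ℤ^n : l_j ≤ x_j ≤ u_j for all j} be the corresponding box. Let b ∈ ℤ^n, v ∈ ℤ, set L = min_{x ∈ X} (b · x − v) and U = max_{x ∈ X} (b · x − v), and let p be a positive integer with p > U − L. Then for every x ∈ X: b · x ≥ v if and only if the residue of b · x − v modulo p (i.e., the unique representative in {0, …, p−1}) lies in {0, …, U}. -/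
open Finset

/-- **Correctness of the modular encoding of integer ordering constraints.** Let `X` be the
integer box determined by bounds `l ≤ u`, let `b ∈ ℤ^n`, `v ∈ ℤ`, let `L` and `U` be the
minimum and maximum of `b ⬝ y - v` over `y ∈ X`, and let `p` be a positive integer with
`p > U - L`. Then for every `x ∈ X`: `b ⬝ x ≥ v` iff the residue of `b ⬝ x - v` modulo `p`
lies in `{0, …, U}`. -/
theorem modular_ordering_encoding {n : ℕ} (hn : 1 ≤ n)
    (l u : Fin n → ℤ) (hlu : ∀ j, l j ≤ u j)
    (b : Fin n → ℤ) (v L U : ℤ)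
    (hL : IsLeast {t : ℤ | ∃ y : Fin n → ℤ,
      (∀ j, l j ≤ y j ∧ y j ≤ u j) ∧ t = (∑ j, b j * y j) - v} L)
    (hU : IsGreatest {t : ℤ | ∃ y : Fin n → ℤ,
      (∀ j, l j ≤ y j ∧ y j ≤ u j) ∧ t = (∑ j, b j * y j) - v} U)
    (p : ℤ) (hp : 0 < p) (hpUL : U - L < p)
    (x : Fin n → ℤ) (hx : ∀ j, l j ≤ x j ∧ x j ≤ u j) :
    v ≤ (∑ j, b j * x j) ↔ ((∑ j, b j * x j) - v) % p ∈ Set.Icc (0 : ℤ) U := by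
  have h1 := hL.2 ⟨x, hx, rfl⟩
  have h2 := hU.2 ⟨x, hx, rfl⟩
  rw [← sub_nonneg]
  generalize (∑ j, b j * x j) - v = t at h1 h2 ⊢
  have h0 := Int.emod_nonneg t hp.ne'
  have hd := Int.emod_add_mul_ediv t p
  rw [Set.mem_Icc]
  constructor
  · intro ht
    have hq : 0 ≤ t / p := Int.ediv_nonneg ht hp.le
    exact ⟨h0, by nlinarith⟩
  · rintro ⟨-, h3⟩
    by_contra ht
    have hq : t / p < 0 := Int.ediv_neg_of_neg_of_pos (not_le.mp ht) hp
    nlinarith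
end

section
/- (Dependency removal by the gadget construction) Let F_q be a finite field, B ∈ F_q^{m×n}, and let D ⊆ {1, …, m} with |D| = d be a minimal linearly dependent set of rows of B, i.e., the rows (b_j)_{j ∈ D} are linearly dependent but every proper subset of them is linearly independent. Fix i ∈ D and an integer k ≥ 1, and define B' ∈ F_q^{(m+k)×(n+k)} as follows: for j ≤ m, the j-th row of B' agrees with the j-th row of B in the first n coordinates, with the last k coordinates all equal to 1 if j = i and all equal to 0 otherwise; for t = 1, …, k, the (m+t)-th row of B' is the standard basis vector e_{n+t}. Then: (a) the rows of B' indexed by D are linearly independent; and (b) the d + k rows of B' indexed by D ∪ {m+1, …, m+k} satisfy a vanishing linear combination in which all d + k coefficients are nonzero; in particular, the kernel of (B')^T contains a vector of Hamming weight exactly d + k. -/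
open Matrix Finset

/-- **Dependency removal by the gadget construction.** Let `D` be a minimal linearly
dependent set of `d` rows of `B : Matrix (Fin m) (Fin n) F`. Fix `i ∈ D` and `k ≥ 1`, and
let `B'` be the gadget matrix: rows `Sum.inl j` extend the rows of `B` by `k` new columns,
all equal to `1` in row `i` and `0` elsewhere; the `k` new rows `Sum.inr t` are the standard
basis vectors of the new columns. Then (a) the rows of `B'` indexed by `D` are linearly
independent; and (b) the `d + k` rows indexed by `D` together with the new rows satisfy a
vanishing linear combination with all `d + k` coefficients nonzero; in particular, the
kernel of `B'ᵀ` contains a vector of Hamming weight exactly `d + k`. -/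
theorem gadget_dependency_removal {F : Type*} [Field F] [Fintype F] [DecidableEq F]
    {m n d k : ℕ} (hk : 1 ≤ k)
    (B : Matrix (Fin m) (Fin n) F) (D : Finset (Fin m)) (hDcard : D.card = d)
    (hdep : ¬ LinearIndependent F (fun j : {x // x ∈ D} => B j.1))
    (hmin : ∀ s : Finset (Fin m), s ⊂ D →
      LinearIndependent F (fun j : {x // x ∈ s} => B j.1))
    (i : Fin m) (hi : i ∈ D)
    (B' : Matrix (Fin m ⊕ Fin k) (Fin n ⊕ Fin k) F)
    (hB'1 : ∀ (j : Fin m) (c : Fin n), B' (Sum.inl j) (Sum.inl c) = B j c)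
    (hB'2 : ∀ (j : Fin m) (t : Fin k), B' (Sum.inl j) (Sum.inr t) = if j = i then 1 else 0)
    (hB'3 : ∀ (t : Fin k) (c : Fin n), B' (Sum.inr t) (Sum.inl c) = 0)
    (hB'4 : ∀ (t t' : Fin k), B' (Sum.inr t) (Sum.inr t') = if t = t' then 1 else 0) :
    LinearIndependent F (fun j : {x // x ∈ D} => B' (Sum.inl j.1)) ∧
    (∃ coef : Fin m ⊕ Fin k → F,
      (∀ j ∈ D, coef (Sum.inl j) ≠ 0) ∧
      (∀ j ∉ D, coef (Sum.inl j) = 0) ∧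
      (∀ t : Fin k, coef (Sum.inr t) ≠ 0) ∧
      ∑ r, coef r • B' r = 0) ∧
    (∃ y : Fin m ⊕ Fin k → F, B'ᵀ *ᵥ y = 0 ∧ hammingNorm y = d + k) := by
  have key : ∀ {c : ℕ} {V : Type _} [AddCommGroup V] [Module F V] (v : Fin c → V)
      (s : Finset (Fin c)), LinearIndependent F (fun j : {x // x ∈ s} => v j.1) ↔
      ∀ g : Fin c → F, ∑ j ∈ s, g j • v j = 0 → ∀ j ∈ s, g j = 0 := fun v s =>
    linearIndepOn_finset_iff (R := F) (v := v) (s := s)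
  -- every vanishing combination of D with a zero coefficient is trivial
  have hz : ∀ g : Fin m → F, ∑ j ∈ D, g j • B j = 0 → ∀ l ∈ D, g l = 0 →
      ∀ j ∈ D, g j = 0 := by
    intro g hg l hl hgl j hj
    by_cases hjl : j = l
    · rw [hjl, hgl]
    · have h := (key (fun j => B j) _).1 (hmin (D.erase l) (Finset.erase_ssubset hl)) g
      refine h ?_ j (Finset.mem_erase.2 ⟨hjl, hj⟩)
      rw [← Finset.add_sum_erase D _ hl, hgl, zero_smul, zero_add] at hg
      exact hg
  have hA : LinearIndependent F (fun j : {x // x ∈ D} => B' (Sum.inl j.1)) := by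
    refine (key (fun j => B' (Sum.inl j)) D).2 ?_
    intro g hg
    refine hz g ?_ i hi ?_
    · ext c
      have := congrFun hg (Sum.inl c)
      simpa [Finset.sum_apply, hB'1] using this
    · have := congrFun hg (Sum.inr ⟨0, hk⟩)
      simpa [Finset.sum_apply, hB'2, hi] using this
  have hC : ∃ coef : Fin m ⊕ Fin k → F,
      (∀ j ∈ D, coef (Sum.inl j) ≠ 0) ∧
      (∀ j ∉ D, coef (Sum.inl j) = 0) ∧
      (∀ t : Fin k, coef (Sum.inr t) ≠ 0) ∧
      ∑ r, coef r • B' r = 0 := by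
    have h1 := mt (key (fun j => B j) D).2 hdep
    push Not at h1
    obtain ⟨g, hg, j0, hj0, hne⟩ := h1
    have hnz : ∀ j ∈ D, g j ≠ 0 := fun j hj h => hne (hz g hg j hj h j0 hj0)
    refine ⟨Sum.elim (fun j => if j ∈ D then g j else 0) (fun _ => - g i), ?_, ?_, ?_, ?_⟩
    · intro j hj
      simpa [hj] using hnz j hj
    · intro j hj
      simp [hj]
    · intro t
      simpa using hnz i hi
    · ext c
      rcases c with c | t
      · have := congrFun hg c
        simpa [Finset.sum_apply, hB'1, hB'3] using this
      · simp [Finset.sum_apply, hB'2, hB'4, hi]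
  refine ⟨hA, hC, ?_⟩
  obtain ⟨y, h1, h2, h3, h4⟩ := hC
  refine ⟨y, ?_, ?_⟩
  · ext c
    have := congrFun h4 c
    simpa [Matrix.mulVec, dotProduct, Finset.sum_apply, mul_comm] using this
  · have : (Finset.univ.filter fun r => y r ≠ 0) = D.disjSum Finset.univ := by
      ext r
      rcases r with j | t
      · by_cases hj : j ∈ D
        · simp [hj, h1 j hj]
        · simp [hj, h2 j hj]
      · simp [h3 t]
    rw [hammingNorm, this, Finset.card_disjSum, hDcard, Finset.card_univ, Fintype.card_fin]
end
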